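/- arXiv:2307.11747 — 2 statements merged into one kernel-verified Lean document; each statement's English description precedes it below -/
import Mathlib

section
/- For every natural number m and every real x, |relu(x) − x·(1 + tanh(2^{m+2}·x))/2| ≤ 2^{−m}. (Thus the function x·Y(x, 2^{m+2}), with Y(x,K) = (1 + tanh(Kx))/2, uniformly approximates the relu function over all of ℝ with error at most 2^{−m}.) -/
/-- The relu function. -/
noncomputable def relu (x : ℝ) : ℝ := max 0 x

theorem one_sub_tanh_eq_exp_neg_div_cosh (t : ℝ) :
    1 - Real.tanh t = Real.exp (-t) / Real.cosh t := by
  rw [Real.tanh_eq_sinh_div_cosh, ← Real.cosh_sub_sinh, sub_div,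
    div_self (Real.cosh_pos t).ne']

theorem one_sub_tanh_nonneg (t : ℝ) : 0 ≤ 1 - Real.tanh t := by
  rw [one_sub_tanh_eq_exp_neg_div_cosh]
  exact div_nonneg (Real.exp_pos _).le (Real.cosh_pos t).le

theorem mul_one_sub_tanh_le_one (t : ℝ) : t * (1 - Real.tanh t) ≤ 1 := by
  rw [one_sub_tanh_eq_exp_neg_div_cosh, ← mul_div_assoc, div_le_one (Real.cosh_pos t)]
  refine le_trans ?_ (Real.one_le_cosh t)
  rw [Real.exp_neg, ← div_eq_mul_inv, div_le_one (Real.exp_pos t)]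
  linarith [Real.add_one_le_exp t]

theorem relu_sub_mul_one_add_tanh (K x : ℝ) :
    relu x - x * (1 + Real.tanh (K * x)) / 2 = |x| * (1 - Real.tanh (K * |x|)) / 2 := by
  unfold relu
  rcases le_total 0 x with hx | hx
  · rw [max_eq_right hx, abs_of_nonneg hx]
    ring
  · rw [max_eq_left hx, abs_of_nonpos hx, mul_neg, Real.tanh_neg]
    ring

theorem abs_relu_sub_mul_one_add_tanh_le {K : ℝ} (hK : 0 < K) (x : ℝ) :
    |relu x - x * (1 + Real.tanh (K * x)) / 2| ≤ K⁻¹ / 2 := by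
  rw [relu_sub_mul_one_add_tanh, abs_of_nonneg
    (div_nonneg (mul_nonneg (abs_nonneg x) (one_sub_tanh_nonneg _)) zero_le_two)]
  gcongr
  rw [← one_div, le_div_iff₀' hK, ← mul_assoc]
  exact mul_one_sub_tanh_le_one _

theorem relu_tanh_uniform_approx (m : ℕ) (x : ℝ) :
    |relu x - x * (1 + Real.tanh ((2 : ℝ) ^ (m + 2) * x)) / 2| ≤ (2 : ℝ) ^ (-(m : ℤ)) := by
  refine (abs_relu_sub_mul_one_add_tanh_le (by positivity) x).trans ?_
  rw [zpow_neg, zpow_natCast, pow_add, mul_inv]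
  have h : (0 : ℝ) < (2 ^ m)⁻¹ := by positivity
  linarith
end

section
/- Let n ≥ 1 and N ≥ 1, let α₁ < α₂ < ⋯ < αₙ be integers, and let V_{i,j} be reals for i ∈ {1,…,n} and j ∈ {0,…,N−1}. Define g : ℝ → ℝ by g(x) = α₁ + Σ_{k=1}^{n−1} sig(1/4, 3/4, x − α_k)·(α_{k+1} − α_k), and let h : ℝ → ℝ be any function such that h(z) = V_{i,j} whenever |z − (N·α_i + j)| ≤ 1/4. Then for every i ∈ {1,…,n}, every j ∈ {0,…,N−1}, every real x with |x − α_i| ≤ 1/4 and every real y with |y − j| ≤ 1/4, one has h(N·g(x) + y) = V_{i,j}. -/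
/-- The piecewise affine sigmoid: 0 for x ≤ a, (x-a)/(b-a) for a ≤ x ≤ b, 1 for x ≥ b. -/
noncomputable def sig (a b x : ℝ) : ℝ :=
  if x ≤ a then 0 else if x ≤ b then (x - a) / (b - a) else 1

theorem sig_of_le {a b x : ℝ} (hx : x ≤ a) : sig a b x = 0 := if_pos hx

theorem sig_of_ge {a b x : ℝ} (hab : a < b) (hx : b ≤ x) : sig a b x = 1 := by
  unfold sig
  rw [if_neg (not_le.mpr (hab.trans_le hx))]
  split_ifs with h
  · rw [le_antisymm h hx]
    exact div_self (sub_pos.mpr hab).ne'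
  · rfl

theorem lt_of_forall_lt_succ {n : ℕ} {α : ℕ → ℤ} (hα : ∀ i, i + 1 < n → α i < α (i + 1))
    {a b : ℕ} (hab : a < b) (hb : b < n) : α a < α b := by
  induction b, hab using Nat.le_induction with
  | base => exact hα a hb
  | succ m _ ih => exact (ih (by omega)).trans (hα m hb)

/-- The staircase built from sigmoids takes the exact value `α i` near `α i`. -/
theorem sum_sig_eq {n : ℕ} {α : ℕ → ℤ} (hα : ∀ i, i + 1 < n → α i < α (i + 1))
    {i : ℕ} (hi : i < n) {x : ℝ} (hx : |x - (α i : ℝ)| ≤ 1/4) :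
    (α 0 : ℝ) + ∑ k ∈ Finset.range (n - 1),
      sig (1/4) (3/4) (x - α k) * ((α (k + 1) : ℝ) - (α k : ℝ)) = α i := by
  obtain ⟨hx₁, hx₂⟩ := abs_le.mp hx
  have hsub : Finset.range i ⊆ Finset.range (n - 1) :=
    Finset.range_subset_range.mpr (by omega)
  rw [← Finset.sum_subset hsub]
  · have hsum : ∑ k ∈ Finset.range i,
        sig (1/4) (3/4) (x - α k) * ((α (k + 1) : ℝ) - (α k : ℝ)) =
        ∑ k ∈ Finset.range i, ((α (k + 1) : ℝ) - (α k : ℝ)) := by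
      refine Finset.sum_congr rfl fun k hk => ?_
      have hlt : α k + 1 ≤ α i := lt_of_forall_lt_succ hα (Finset.mem_range.mp hk) hi
      have hlt' : (α k : ℝ) + 1 ≤ α i := by exact_mod_cast hlt
      rw [sig_of_ge (by norm_num) (by linarith), one_mul]
    rw [hsum, Finset.sum_range_sub (fun k => (α k : ℝ))]
    ring
  · intro k hk hki
    rw [Finset.mem_range] at hk hki
    have hle : α i ≤ α k := by
      rcases (not_lt.mp hki).eq_or_lt with rfl | hik
      · exact le_rfl
      · exact (lt_of_forall_lt_succ hα hik (by omega)).le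
    have hle' : (α i : ℝ) ≤ α k := by exact_mod_cast hle
    rw [sig_of_le (by linarith), zero_mul]

theorem send_pairs (n N : ℕ) (hn : 1 ≤ n) (hN : 1 ≤ N) (α : ℕ → ℤ)
    (V : ℕ → ℕ → ℝ)
    (hα : ∀ i, i + 1 < n → α i < α (i + 1))
    (g : ℝ → ℝ)
    (hg : ∀ x, g x = (α 0 : ℝ) + ∑ k ∈ Finset.range (n - 1),
      sig (1/4) (3/4) (x - α k) * ((α (k + 1) : ℝ) - (α k : ℝ)))
    (h : ℝ → ℝ)
    (hh : ∀ i, i < n → ∀ j, j < N → ∀ z : ℝ,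
      |z - ((N : ℝ) * (α i : ℝ) + (j : ℝ))| ≤ 1/4 → h z = V i j)
    (i : ℕ) (hi : i < n) (j : ℕ) (hj : j < N) (x y : ℝ)
    (hx : |x - (α i : ℝ)| ≤ 1/4) (hy : |y - (j : ℝ)| ≤ 1/4) :
    h ((N : ℝ) * g x + y) = V i j := by
  refine hh i hi j hj _ ?_
  rw [hg, sum_sig_eq hα hi hx, add_sub_add_left_eq_sub]
  exact hy
end
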